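/- arXiv:1407.3037 — 4 statements merged into one kernel-verified Lean document; each statement's English description precedes it below -/
import Mathlib

section
/- (Filtered back-projection inversion formula f = (1/4π) R* Λ_s R f.) Let f be a Schwartz function on ℝ². For θ ∈ S¹ define g_θ(τ) = (1/√(2π)) ∫_ℝ e^{-iτs} Rf(θ,s) ds. Then for every x ∈ ℝ², all the integrals below converge absolutely and f(x) = (1/(4π)) ∫_{S¹} ( (1/√(2π)) ∫_ℝ e^{iτ(x·θ)} |τ| · g_θ(τ) dτ ) dθ. -/
open MeasureTheory Real Complex

/-- The Radon transform `Rf(θ,s) = ∫_ℝ f(sθ + tθ^⊥) dt`. -/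
noncomputable def Radon (f : SchwartzMap (ℝ × ℝ) ℂ) (θ : ℝ × ℝ) (s : ℝ) : ℂ :=
  ∫ t : ℝ, f (s • θ + t • (-θ.2, θ.1))

/-- `g_θ(τ) = (1/√(2π)) ∫_ℝ e^{-iτs} Rf(θ,s) ds`. -/
noncomputable def gRadon (f : SchwartzMap (ℝ × ℝ) ℂ) (θ : ℝ × ℝ) (τ : ℝ) : ℂ :=
  (1 / (Real.sqrt (2 * π) : ℂ)) * ∫ s : ℝ, Complex.exp (-(Complex.I * τ * s)) * Radon f θ s

open scoped FourierTransform

/-- The unit vector at angle `φ`, as a complex number. -/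
noncomputable def uvec (φ : ℝ) : ℂ := (Real.cos φ : ℂ) + (Real.sin φ : ℂ) * Complex.I

lemma uvec_cont : Continuous uvec := by
  unfold uvec
  exact (Complex.continuous_ofReal.comp Real.continuous_cos).add
    ((Complex.continuous_ofReal.comp Real.continuous_sin).mul continuous_const)

lemma uvec_re (φ : ℝ) : (uvec φ).re = Real.cos φ := by
  rw [uvec, Complex.add_re, Complex.mul_I_re, Complex.ofReal_re, Complex.ofReal_im]; ring

lemma uvec_im (φ : ℝ) : (uvec φ).im = Real.sin φ := by
  rw [uvec, Complex.add_im, Complex.mul_I_im, Complex.ofReal_re, Complex.ofReal_im]; ring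

lemma uvec_eq (φ : ℝ) : uvec φ = ((Circle.exp φ : Circle) : ℂ) := by
  rw [Circle.coe_exp, Complex.exp_mul_I, uvec]
  push_cast; ring

lemma uvec_norm (φ : ℝ) : ‖uvec φ‖ = 1 := by rw [uvec_eq]; simp

lemma uvec_add_pi (φ : ℝ) : uvec (φ + π) = - uvec φ := by
  simp [uvec, Real.cos_add_pi, Real.sin_add_pi]; ring

lemma uvec_periodic (φ : ℝ) : uvec (φ + 2 * π) = uvec φ := by
  simp [uvec]

section polar
variable {Φ : ℂ → ℂ} {C : ℝ}

lemma polar_bound (hb : ∀ w, ‖w‖ * ‖Φ w‖ ≤ C * (1 + ‖w‖ ^ 2)⁻¹) (φ r : ℝ) :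
    ‖((|r| : ℝ) : ℂ) * Φ (r * uvec φ)‖ ≤ C * (1 + r ^ 2)⁻¹ := by
  have := hb (r * uvec φ)
  simpa [uvec_norm] using this

lemma polar_meas (hc : Continuous Φ) :
    Continuous (fun p : ℝ × ℝ => ((|p.1| : ℝ) : ℂ) * Φ (p.1 * uvec p.2)) := by
  have := uvec_cont
  fun_prop

lemma polar_int (hc : Continuous Φ) (hb : ∀ w, ‖w‖ * ‖Φ w‖ ≤ C * (1 + ‖w‖ ^ 2)⁻¹) (φ : ℝ) :
    Integrable (fun r : ℝ => ((|r| : ℝ) : ℂ) * Φ (r * uvec φ)) := by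
  refine (integrable_inv_one_add_sq.const_mul C).mono' ?_ (ae_of_all _ (polar_bound hb φ))
  exact ((polar_meas hc).comp (Continuous.prodMk_left φ)).aestronglyMeasurable

lemma polar_cont (hc : Continuous Φ) (hb : ∀ w, ‖w‖ * ‖Φ w‖ ≤ C * (1 + ‖w‖ ^ 2)⁻¹) (S : Set ℝ) :
    Continuous (fun φ : ℝ => ∫ r : ℝ in S, ((|r| : ℝ) : ℂ) * Φ (r * uvec φ)) := by
  refine continuous_of_dominated (bound := fun r => C * (1 + r ^ 2)⁻¹) ?_ ?_ ?_ ?_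
  · intro φ
    exact ((polar_meas hc).comp (Continuous.prodMk_left φ)).aestronglyMeasurable
  · intro φ
    exact ae_of_all _ (polar_bound hb φ)
  · exact (integrable_inv_one_add_sq.const_mul C).integrableOn
  · refine ae_of_all _ fun r => ?_
    exact (polar_meas hc).comp (Continuous.prodMk_right r)

lemma polar_main (hc : Continuous Φ) (hb : ∀ w, ‖w‖ * ‖Φ w‖ ≤ C * (1 + ‖w‖ ^ 2)⁻¹) :
    ∫ φ in (0 : ℝ)..(2 * π), ∫ r : ℝ, ((|r| : ℝ) : ℂ) * Φ (r * uvec φ) = 2 * ∫ w, Φ w := by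
  set M : ℝ → ℂ := fun φ => ∫ r : ℝ in Set.Ioi 0, ((|r| : ℝ) : ℂ) * Φ (r * uvec φ) with hM
  have hMc : Continuous M := polar_cont hc hb _
  have hMp : Function.Periodic M (2 * π) := by
    intro φ
    simp only [hM, uvec_periodic]
  have hsplit : ∀ φ, ∫ r : ℝ, ((|r| : ℝ) : ℂ) * Φ (r * uvec φ) = M (φ + π) + M φ := by
    intro φ
    have hi := polar_int hc hb φ
    rw [← intervalIntegral.integral_Iic_add_Ioi (b := 0) hi.integrableOn hi.integrableOn]
    congr 1
    rw [← neg_zero, ← integral_comp_neg_Ioi]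
    simp only [hM, uvec_add_pi]
    simp
  simp_rw [hsplit]
  have hMc' : Continuous fun φ => M (φ + π) := hMc.comp (continuous_add_const π)
  rw [intervalIntegral.integral_add (hMc'.intervalIntegrable _ _) (hMc.intervalIntegrable _ _),
    intervalIntegral.integral_comp_add_right]
  have h1 : ∫ x in (0 + π)..(2 * π + π), M x = ∫ x in (-π)..(-π + 2 * π), M x := by
    rw [← hMp.intervalIntegral_add_eq (0 + π)]
    congr 1; ring
  have h2 : ∫ x in (0 : ℝ)..(2 * π), M x = ∫ x in (-π)..(-π + 2 * π), M x := by
    rw [← hMp.intervalIntegral_add_eq 0]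
    congr 1; ring
  have h3 : ∫ x in (-π)..(-π + 2 * π), M x = ∫ w, Φ w := by
    rw [show -π + 2 * π = π by ring, intervalIntegral.integral_of_le (by linarith [Real.pi_pos]),
      integral_Ioc_eq_integral_Ioo, ← Complex.integral_comp_polarCoord_symm]
    have hI : IntegrableOn (fun p : ℝ × ℝ => ((|p.1| : ℝ) : ℂ) * Φ (p.1 * uvec p.2))
        (Set.Ioi 0 ×ˢ Set.Ioo (-π) π) (volume.prod volume) := by
      rw [IntegrableOn, ← Measure.prod_restrict]
      have hB := Integrable.mul_prod (μ := volume.restrict (Set.Ioi (0:ℝ)))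
        (ν := volume.restrict (Set.Ioo (-π) π)) (f := fun r : ℝ => C * (1 + r ^ 2)⁻¹)
        (g := fun _ => (1 : ℝ))
        (integrable_inv_one_add_sq.const_mul C).integrableOn (integrable_const _)
      refine hB.mono' (polar_meas hc).aestronglyMeasurable (ae_of_all _ fun p => ?_)
      simpa using polar_bound hb p.2 p.1
    have hsw : ∫ φ in Set.Ioo (-π) π, M φ =
        ∫ p in Set.Ioi 0 ×ˢ Set.Ioo (-π) π, ((|p.1| : ℝ) : ℂ) * Φ (p.1 * uvec p.2) := by
      rw [Measure.volume_eq_prod, ← Measure.prod_restrict, integral_prod_symm]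
      rw [IntegrableOn, ← Measure.prod_restrict] at hI
      exact hI
    rw [hsw]
    refine setIntegral_congr_fun (measurableSet_Ioi.prod measurableSet_Ioo) ?_
    rintro ⟨r, φ⟩ ⟨hr, -⟩
    have hr : 0 < r := hr
    simp [Complex.polarCoord_symm_apply, uvec, abs_of_pos hr]
  rw [h1, h2, h3]; ring
end polar

/-- Transport of `f` to `ℂ`. -/
noncomputable def toC (f : SchwartzMap (ℝ × ℝ) ℂ) : SchwartzMap ℂ ℂ :=
  SchwartzMap.compCLMOfContinuousLinearEquiv ℂ Complex.equivRealProdCLM f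

lemma toC_apply (f : SchwartzMap (ℝ × ℝ) ℂ) (z : ℂ) : toC f z = f (z.re, z.im) := rfl

/-- Rotated coordinates. -/
noncomputable def rotc (φ : ℝ) (p : ℝ × ℝ) : ℂ :=
  rotation (Circle.exp φ) (Complex.measurableEquivRealProd.symm p)

lemma rotc_apply (φ : ℝ) (p : ℝ × ℝ) : rotc φ p = uvec φ * (p.1 + p.2 * Complex.I) := by
  rw [rotc, rotation_apply, uvec_eq]
  congr 1
  apply Complex.ext <;> simp

lemma rotc_mp (φ : ℝ) : MeasurePreserving (rotc φ) := by
  exact (LinearIsometryEquiv.measurePreserving (rotation (Circle.exp φ))).comp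
    Complex.volume_preserving_equiv_real_prod.symm

lemma rotc_emb (φ : ℝ) : MeasurableEmbedding (rotc φ) :=
  (rotation (Circle.exp φ)).toHomeomorph.measurableEmbedding.comp
    Complex.measurableEquivRealProd.symm.measurableEmbedding

lemma toC_rotc (f : SchwartzMap (ℝ × ℝ) ℂ) (φ s t : ℝ) :
    f (s • (Real.cos φ, Real.sin φ) + t • (-Real.sin φ, Real.cos φ)) = toC f (rotc φ (s, t)) := by
  rw [toC_apply, rotc_apply]
  congr 1
  simp [uvec_re, uvec_im]
  constructor <;> ring

lemma rotc_int (f : SchwartzMap (ℝ × ℝ) ℂ) (φ : ℝ) :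
    Integrable (fun p : ℝ × ℝ => toC f (rotc φ p)) (volume.prod volume) :=
  ((rotc_mp φ).integrable_comp_emb (rotc_emb φ)).2 (toC f).integrable

lemma Radon_eq (f : SchwartzMap (ℝ × ℝ) ℂ) (φ s : ℝ) :
    Radon f (Real.cos φ, Real.sin φ) s = ∫ t, toC f (rotc φ (s, t)) := by
  simp_rw [← toC_rotc]; rfl

lemma Radon_int (f : SchwartzMap (ℝ × ℝ) ℂ) (φ : ℝ) :
    Integrable (fun s : ℝ => Radon f (Real.cos φ, Real.sin φ) s) := by
  simp_rw [Radon_eq]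
  exact (rotc_int f φ).integral_prod_left

lemma rotc_inner (φ s t τ : ℝ) :
    inner ℝ (rotc φ (s, t)) (((τ / (2 * π) : ℝ) : ℂ) * uvec φ) = s * (τ / (2 * π)) := by
  rw [rotc_apply, Complex.inner]
  generalize τ / (2 * π) = q
  simp [uvec_re, uvec_im]
  have := Real.sin_sq_add_cos_sq φ
  linear_combination (s * q) * this

lemma gRadon_eq (f : SchwartzMap (ℝ × ℝ) ℂ) (φ τ : ℝ) :
    gRadon f (Real.cos φ, Real.sin φ) τ = (1 / (Real.sqrt (2 * π) : ℂ)) *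
      (𝓕 (toC f)) (((τ / (2 * π) : ℝ) : ℂ) * uvec φ) := by
  rw [gRadon]
  congr 1
  rw [SchwartzMap.fourier_coe, Real.fourier_eq', ← (rotc_mp φ).integral_comp (rotc_emb φ),
    Measure.volume_eq_prod, integral_prod]
  · refine integral_congr_ae (ae_of_all _ fun s => ?_)
    simp only [Radon_eq, rotc_inner, smul_eq_mul]
    rw [integral_const_mul]
    congr 2
    have : (π : ℂ) ≠ 0 := by exact_mod_cast Real.pi_ne_zero
    push_cast
    field_simp
  · refine (rotc_int f φ).mono ?_ (ae_of_all _ fun p => ?_)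
    · refine AEStronglyMeasurable.smul (f := fun p : ℝ × ℝ => Complex.exp _) ?_
        (rotc_int f φ).aestronglyMeasurable
      have : Continuous (fun p : ℝ × ℝ => rotc φ p) := by
        simp_rw [rotc_apply]; fun_prop
      exact Continuous.aestronglyMeasurable (by fun_prop)
    · rw [norm_smul, Complex.norm_exp_ofReal_mul_I, one_mul]

lemma schwartz_bound (K : SchwartzMap ℂ ℂ) :
    ∃ C, ∀ w, ‖w‖ * ‖K w‖ ≤ C * (1 + ‖w‖ ^ 2)⁻¹ := by
  obtain ⟨C1, -, h1⟩ := K.decay 1 0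
  obtain ⟨C3, -, h3⟩ := K.decay 3 0
  refine ⟨C1 + C3, fun w => ?_⟩
  have a := h1 w
  have b := h3 w
  rw [norm_iteratedFDeriv_zero] at a b
  rw [← div_eq_mul_inv, le_div_iff₀ (by positivity)]
  nlinarith

/-- Filtered back-projection inversion formula `f = (1/4π) R^* Λ_s R f`: all integrals
converge absolutely and
`f(x) = (1/(4π)) ∫_{S¹} ((1/√(2π)) ∫_ℝ e^{iτ(x·θ)} |τ| g_θ(τ) dτ) dθ`, the circle being
parametrized by arclength as `θ(φ) = (cos φ, sin φ)`, `φ ∈ [0, 2π]`. -/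
theorem stmt_2 (f : SchwartzMap (ℝ × ℝ) ℂ) (x : ℝ × ℝ) :
    (∀ φ : ℝ, Integrable (fun s : ℝ => Radon f (Real.cos φ, Real.sin φ) s)) ∧
    (∀ φ : ℝ, Integrable (fun τ : ℝ =>
        Complex.exp (Complex.I * τ * (x.1 * Real.cos φ + x.2 * Real.sin φ)) *
          (|τ| : ℝ) * gRadon f (Real.cos φ, Real.sin φ) τ)) ∧
    IntervalIntegrable (fun φ : ℝ =>
        (1 / (Real.sqrt (2 * π) : ℂ)) *
          ∫ τ : ℝ, Complex.exp (Complex.I * τ * (x.1 * Real.cos φ + x.2 * Real.sin φ)) *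
            (|τ| : ℝ) * gRadon f (Real.cos φ, Real.sin φ) τ)
      volume 0 (2 * π) ∧
    f x = (1 / (4 * (π : ℂ))) *
        ∫ φ in (0 : ℝ)..(2 * π),
          (1 / (Real.sqrt (2 * π) : ℂ)) *
            ∫ τ : ℝ, Complex.exp (Complex.I * τ * (x.1 * Real.cos φ + x.2 * Real.sin φ)) *
              (|τ| : ℝ) * gRadon f (Real.cos φ, Real.sin φ) τ := by
  set z : ℂ := (x.1 : ℂ) + x.2 * Complex.I with hz
  set K : SchwartzMap ℂ ℂ := 𝓕 (toC f) with hK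
  set Φ : ℂ → ℂ := fun w => Complex.exp (((2 * π * inner ℝ w z : ℝ) : ℂ) * Complex.I) • K w with hΦ
  have hfx : f x = ∫ w, Φ w := by
    have h1 : (𝓕⁻ (𝓕 (toC f))) z = toC f z := by rw [FourierPair.fourierInv_fourier_eq]
    rw [SchwartzMap.fourierInv_coe, Real.fourierInv_eq', toC_apply] at h1
    rw [h1]
    simp [hz]
  have hc : Continuous Φ := by
    have := K.continuous
    fun_prop
  obtain ⟨C, hC⟩ := schwartz_bound K
  have hb : ∀ w, ‖w‖ * ‖Φ w‖ ≤ C * (1 + ‖w‖ ^ 2)⁻¹ := by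
    intro w
    rw [hΦ]
    simp only [norm_smul, Complex.norm_exp_ofReal_mul_I, one_mul]
    exact hC w
  have hpi : (π : ℂ) ≠ 0 := by exact_mod_cast Real.pi_ne_zero
  have hsq : (Real.sqrt (2 * π) : ℂ) * (Real.sqrt (2 * π) : ℂ) = 2 * π := by
    rw [← Complex.ofReal_mul, Real.mul_self_sqrt (by positivity)]; push_cast; rfl
  have hs0 : (Real.sqrt (2 * π) : ℂ) ≠ 0 := by
    intro h; rw [h] at hsq; simp [hpi] at hsq
  have key : ∀ φ τ : ℝ, Complex.exp (Complex.I * τ * (x.1 * Real.cos φ + x.2 * Real.sin φ)) *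
          (|τ| : ℝ) * gRadon f (Real.cos φ, Real.sin φ) τ = (Real.sqrt (2 * π) : ℂ) *
          (((|τ / (2 * π)| : ℝ) : ℂ) * Φ (((τ / (2 * π) : ℝ) : ℂ) * uvec φ)) := by
    intro φ τ
    rw [gRadon_eq, hΦ]
    simp only [smul_eq_mul]
    have hin : inner ℝ (((τ / (2 * π) : ℝ) : ℂ) * uvec φ) z =
        τ / (2 * π) * (x.1 * Real.cos φ + x.2 * Real.sin φ) := by
      rw [Complex.inner, hz]
      generalize τ / (2 * π) = q
      simp [uvec_re, uvec_im]
      ring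
    rw [hin, abs_div, abs_of_pos (show (0:ℝ) < 2 * π by positivity)]
    have he : (((2 * π * (τ / (2 * π) * (x.1 * Real.cos φ + x.2 * Real.sin φ)) : ℝ) : ℂ)
        * Complex.I) = Complex.I * τ * (x.1 * Real.cos φ + x.2 * Real.sin φ) := by
      push_cast; field_simp
    generalize K (((τ / (2 * π) : ℝ) : ℂ) * uvec φ) = k
    rw [he, Complex.ofReal_div, Complex.ofReal_mul, Complex.ofReal_ofNat, ← hsq]
    field_simp
  have hF := fun φ => (polar_int hc hb φ).comp_div (R := 2 * π) (by positivity)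
  have hval : ∀ φ : ℝ, (1 / (Real.sqrt (2 * π) : ℂ)) *
          ∫ τ : ℝ, Complex.exp (Complex.I * τ * (x.1 * Real.cos φ + x.2 * Real.sin φ)) *
            (|τ| : ℝ) * gRadon f (Real.cos φ, Real.sin φ) τ =
      (2 * π) * ∫ r : ℝ, ((|r| : ℝ) : ℂ) * Φ (r * uvec φ) := by
    intro φ
    simp_rw [key]
    rw [integral_const_mul, Measure.integral_comp_div
      (fun r : ℝ => ((|r| : ℝ) : ℂ) * Φ (r * uvec φ)) (2 * π),
      abs_of_pos (show (0:ℝ) < 2 * π by positivity), Complex.real_smul]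
    generalize (∫ r : ℝ, ((|r| : ℝ) : ℂ) * Φ (r * uvec φ)) = J
    push_cast
    field_simp
  refine ⟨Radon_int f, fun φ => ?_, ?_, ?_⟩
  · simp_rw [key]
    exact (hF φ).const_mul _
  · simp_rw [hval]
    have := polar_cont hc hb Set.univ
    simp only [Measure.restrict_univ] at this
    exact (continuous_const.mul this).intervalIntegrable _ _
  · simp_rw [hval]
    rw [intervalIntegral.integral_const_mul, polar_main hc hb, hfx]
    field_simp
    norm_num
end

section
/- (Lambda tomography identity Λf = F^{-1}(|ξ| f̂).) Let f be a Schwartz function on ℝ². Then for every θ ∈ S¹ the function s ↦ Rf(θ,s) is twice continuously differentiable, and for every x ∈ ℝ², (1/(4π)) ∫_{S¹} ( -(∂²/∂s²) Rf(θ,s) )|_{s = x·θ} dθ = (1/(2π)) ∫_{ℝ²} e^{i x·ξ} |ξ| f̂(ξ) dξ. -/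
open MeasureTheory Real Complex

/-- The 2D Fourier transform `f̂(ξ) = (1/(2π)) ∫_{ℝ²} e^{-ix·ξ} f(x) dx`. -/
noncomputable def fourier2 (f : SchwartzMap (ℝ × ℝ) ℂ) (ξ : ℝ × ℝ) : ℂ :=
  (1 / (2 * (π : ℂ))) *
    ∫ x : ℝ × ℝ, Complex.exp (-(Complex.I * (x.1 * ξ.1 + x.2 * ξ.2))) * f x

open scoped FourierTransform SchwartzMap

lemma aux_decay (f : 𝓢(ℝ × ℝ, ℂ)) (k : ℕ) :
    ∃ C : ℝ, 0 ≤ C ∧ ∀ x, (1 + ‖x‖) ^ k * ‖f x‖ ≤ C := by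
  refine ⟨2 ^ k * (Finset.Iic (k, 0)).sup (fun m => SchwartzMap.seminorm ℝ m.1 m.2) f,
    by positivity, fun x => ?_⟩
  have := SchwartzMap.one_add_le_sup_seminorm_apply (𝕜 := ℝ) (m := (k, 0)) (k := k) (n := 0)
    le_rfl le_rfl f x
  simpa only [norm_iteratedFDeriv_zero] using this

noncomputable def rotLM (θ : ℝ × ℝ) : (ℝ × ℝ) →ₗ[ℝ] (ℝ × ℝ) :=
  Matrix.toLin (.finTwoProd ℝ) (.finTwoProd ℝ) !![θ.1, -θ.2; θ.2, θ.1]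

lemma rotLM_apply (θ p : ℝ × ℝ) : rotLM θ p = p.1 • θ + p.2 • (-θ.2, θ.1) := by
  unfold rotLM
  rw [Matrix.toLin_finTwoProd_apply]
  ext <;> simp <;> ring

lemma rotLM_det (θ : ℝ × ℝ) (h : θ.1 ^ 2 + θ.2 ^ 2 = 1) : LinearMap.det (rotLM θ) = 1 := by
  unfold rotLM
  rw [LinearMap.det_toLin, Matrix.det_fin_two_of]
  linarith

lemma rot_mp (θ : ℝ × ℝ) (h : θ.1 ^ 2 + θ.2 ^ 2 = 1) :
    MeasurePreserving (rotLM θ) (volume : Measure (ℝ × ℝ)) volume := by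
  refine ⟨(LinearMap.continuous_of_finiteDimensional _).measurable, ?_⟩
  rw [Measure.map_linearMap_addHaar_eq_smul_addHaar _ (by rw [rotLM_det θ h]; exact one_ne_zero),
    rotLM_det θ h]
  simp

noncomputable def rotCLE (θ : ℝ × ℝ) (h : θ.1 ^ 2 + θ.2 ^ 2 = 1) : (ℝ × ℝ) ≃L[ℝ] (ℝ × ℝ) :=
  (LinearEquiv.ofIsUnitDet (f := rotLM θ) (v := .finTwoProd ℝ) (v' := .finTwoProd ℝ) (by
    rw [LinearMap.det_toMatrix, rotLM_det θ h]; exact isUnit_one)).toContinuousLinearEquiv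

lemma rotCLE_apply (θ p : ℝ × ℝ) (h : θ.1 ^ 2 + θ.2 ^ 2 = 1) :
    rotCLE θ h p = rotLM θ p := rfl

noncomputable def rotS (f : 𝓢(ℝ × ℝ, ℂ)) (θ : ℝ × ℝ) (h : θ.1 ^ 2 + θ.2 ^ 2 = 1) :
    𝓢(ℝ × ℝ, ℂ) :=
  SchwartzMap.compCLMOfContinuousLinearEquiv ℂ (rotCLE θ h) f

lemma rotS_apply (f : 𝓢(ℝ × ℝ, ℂ)) (θ : ℝ × ℝ) (h : θ.1 ^ 2 + θ.2 ^ 2 = 1) (p : ℝ × ℝ) :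
    rotS f θ h p = f (p.1 • θ + p.2 • (-θ.2, θ.1)) := by
  rw [← rotLM_apply]; rfl

lemma radon_eq (f : 𝓢(ℝ × ℝ, ℂ)) (θ : ℝ × ℝ) (h : θ.1 ^ 2 + θ.2 ^ 2 = 1) :
    (fun s => Radon f θ s) = fun s => ∫ t : ℝ, rotS f θ h (s, t) := by
  ext s
  simp [Radon, rotS_apply]

lemma cont_int (k : 𝓢(ℝ × ℝ, ℂ)) : Continuous (fun s : ℝ => ∫ t : ℝ, k (s, t)) := by
  obtain ⟨C, hC0, hC⟩ := aux_decay k 2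
  refine continuous_of_dominated (bound := fun t => C * (1 + t ^ 2)⁻¹) ?_ ?_ ?_ ?_
  · intro s
    exact (k.continuous.comp (by fun_prop)).aestronglyMeasurable
  · intro s
    refine Filter.Eventually.of_forall fun t => ?_
    have h1 := hC (s, t)
    have h2 : |t| ≤ ‖(s, t)‖ := norm_snd_le (s, t)
    have h3 : (1 + t ^ 2) ≤ (1 + ‖(s, t)‖) ^ 2 := by
      nlinarith [abs_nonneg t, sq_abs t]
    rw [← div_eq_mul_inv, le_div_iff₀ (by positivity), mul_comm]
    exact (mul_le_mul_of_nonneg_right h3 (norm_nonneg _)).trans h1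
  · exact integrable_inv_one_add_sq.const_mul C
  · refine Filter.Eventually.of_forall fun t => ?_
    exact k.continuous.comp (by fun_prop)

lemma radon_integrable (f : 𝓢(ℝ × ℝ, ℂ)) (θ : ℝ × ℝ) (h : θ.1 ^ 2 + θ.2 ^ 2 = 1) :
    Integrable (fun s => Radon f θ s) := by
  rw [radon_eq f θ h]
  have : Integrable (rotS f θ h) ((volume : Measure ℝ).prod volume) := (rotS f θ h).integrable
  exact this.integral_prod_left

/-- Fourier slice. -/
lemma slice (f : 𝓢(ℝ × ℝ, ℂ)) (θ : ℝ × ℝ) (h : θ.1 ^ 2 + θ.2 ^ 2 = 1) (w : ℝ) :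
    𝓕 (fun s => Radon f θ s) w = 2 * π * fourier2 f ((2 * π * w) • θ) := by
  have hpi : (π : ℂ) ≠ 0 := by exact_mod_cast Real.pi_ne_zero
  rw [Real.fourier_real_eq_integral_exp_smul, fourier2, ← mul_assoc,
    mul_one_div_cancel (by simp [hpi]), one_mul]
  have e := (rot_mp θ h).integral_comp
    (rotCLE θ h).toHomeomorph.measurableEmbedding
    (fun x : ℝ × ℝ => Complex.exp (-(Complex.I * (x.1 * ((2 * π * w) • θ).1
      + x.2 * ((2 * π * w) • θ).2))) * f x)
  rw [← e]
  have hint : Integrable (fun p : ℝ × ℝ => Complex.exp (↑(-2 * π * p.1 * w) * I) * rotS f θ h p)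
      ((volume : Measure ℝ).prod volume) := by
    have : Integrable (rotS f θ h) ((volume : Measure ℝ).prod volume) := (rotS f θ h).integrable
    refine this.bdd_mul (c := 1) ?_ ?_
    · exact (by fun_prop : Continuous fun p : ℝ × ℝ =>
        Complex.exp (↑(-2 * π * p.1 * w) * I)).aestronglyMeasurable
    · exact Filter.Eventually.of_forall fun p => (Complex.norm_exp_ofReal_mul_I _).le
  have hp := integral_prod _ hint
  calc _ = ∫ s : ℝ, ∫ t : ℝ, Complex.exp (↑(-2 * π * s * w) * I) * rotS f θ h (s, t) := by
        congr 1; ext s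
        rw [integral_const_mul, congrFun (radon_eq f θ h) s, smul_eq_mul]
    _ = _ := hp.symm
    _ = _ := by
        rw [← Measure.volume_eq_prod]
        congr 1; ext p
        rw [rotS_apply, ← rotLM_apply]
        congr 2
        have h' : (θ.1 : ℂ) ^ 2 + (θ.2 : ℂ) ^ 2 = 1 := by exact_mod_cast h
        rw [rotLM_apply]
        simp
        linear_combination (-(2 * π * p.1 * w * I)) * h'

/-- `fourier2 f` is Schwartz -/
lemma fourier2_schwartz (f : 𝓢(ℝ × ℝ, ℂ)) : ∃ G : 𝓢(ℝ × ℝ, ℂ), ∀ ξ, fourier2 f ξ = G ξ := by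
  let F : 𝓢(ℂ, ℂ) := SchwartzMap.compCLMOfContinuousLinearEquiv ℂ Complex.equivRealProdCLM f
  let H : 𝓢(ℂ, ℂ) := 𝓕 F
  let e : (ℝ × ℝ) ≃L[ℝ] ℂ := Complex.equivRealProdCLM.symm.trans
    (ContinuousLinearEquiv.smulLeft (Units.mk0 ((2 * π)⁻¹ : ℝ) (by positivity)))
  refine ⟨(1 / (2 * (π : ℂ))) • SchwartzMap.compCLMOfContinuousLinearEquiv ℂ e H, fun ξ => ?_⟩
  have hpi : (π : ℂ) ≠ 0 := by exact_mod_cast Real.pi_ne_zero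
  have he : e ξ = (2 * π)⁻¹ • (Complex.equivRealProdCLM.symm ξ) := rfl
  simp only [smul_apply, SchwartzMap.compCLMOfContinuousLinearEquiv_apply, fourier2,
    smul_eq_mul, Function.comp]
  congr 1
  rw [he]
  simp only [H]
  rw [SchwartzMap.fourier_coe, Real.fourier_eq']
  rw [← Complex.volume_preserving_equiv_real_prod.integral_comp
    Complex.measurableEquivRealProd.measurableEmbedding]
  congr 1; ext v
  simp only [F, SchwartzMap.compCLMOfContinuousLinearEquiv_apply, smul_eq_mul, Function.comp]
  congr 2
  simp [Complex.inner, Complex.equivRealProdCLM_symm_apply]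
  field_simp

noncomputable def lineS (G : 𝓢(ℝ × ℝ, ℂ)) (θ : ℝ × ℝ) (h : θ.1 ^ 2 + θ.2 ^ 2 = 1) : 𝓢(ℝ, ℂ) :=
  SchwartzMap.compCLMOfAntilipschitz ℂ (K := 1) (g := fun w : ℝ => (2 * π * w) • θ)
    (by
      have := (((2 * π) • ContinuousLinearMap.id ℝ ℝ).smulRight θ).hasTemperateGrowth
      convert this using 1
      ext w <;> simp)
    (by
      refine AntilipschitzWith.of_le_mul_dist fun x y => ?_
      have h1 : (1 : ℝ) ≤ 2 * ‖θ‖ := by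
        have a := norm_fst_le θ
        have b := norm_snd_le θ
        simp only [Real.norm_eq_abs] at a b
        nlinarith [abs_nonneg θ.1, abs_nonneg θ.2, sq_abs θ.1, sq_abs θ.2, norm_nonneg θ]
      simp only [NNReal.coe_one, one_mul]
      rw [dist_eq_norm, dist_eq_norm, ← sub_smul, norm_smul, ← mul_sub, norm_mul]
      rw [Real.norm_of_nonneg (by positivity : 0 ≤ 2 * π)]
      nlinarith [Real.pi_gt_three, norm_nonneg (x - y), mul_nonneg (norm_nonneg (x - y)) (norm_nonneg θ), mul_le_mul_of_nonneg_left h1 (norm_nonneg (x - y))]) G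

lemma lineS_apply (G : 𝓢(ℝ × ℝ, ℂ)) (θ : ℝ × ℝ) (h : θ.1 ^ 2 + θ.2 ^ 2 = 1) (w : ℝ) :
    lineS G θ h w = G ((2 * π * w) • θ) := rfl

lemma radon_inv (f G : 𝓢(ℝ × ℝ, ℂ)) (hG : ∀ ξ, fourier2 f ξ = G ξ) (θ : ℝ × ℝ)
    (h : θ.1 ^ 2 + θ.2 ^ 2 = 1) :
    (fun s => Radon f θ s) = 𝓕⁻ ((2 * (π : ℂ)) • lineS G θ h) := by
  have h1 : 𝓕 (fun s => Radon f θ s) = ((2 * (π : ℂ)) • lineS G θ h : 𝓢(ℝ, ℂ)) := by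
    ext w
    rw [slice f θ h, hG, smul_apply, lineS_apply, smul_eq_mul]
  rw [SchwartzMap.fourierInv_coe, ← h1]
  refine (Continuous.fourierInv_fourier_eq ?_ (radon_integrable f θ h) ?_).symm
  · rw [radon_eq f θ h]; exact cont_int _
  · rw [h1]; exact SchwartzMap.integrable _

lemma deriv2_fourierInv (u : 𝓢(ℝ, ℂ)) (s : ℝ) :
    iteratedDeriv 2 (𝓕⁻ u : 𝓢(ℝ, ℂ)) s =
      - ∫ w : ℝ, Complex.exp (I * (2 * π * w) * s) * ((2 * π * w) ^ 2 * u w) := by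
  have h0 : ((𝓕⁻ u : 𝓢(ℝ, ℂ)) : ℝ → ℂ) = fun s => (𝓕 (u : ℝ → ℂ)) (-s) := by
    ext s
    rw [SchwartzMap.fourierInv_coe, Real.fourierInv_eq_fourier_neg]
  rw [h0, iteratedDeriv_comp_neg, Real.iteratedDeriv_fourier (N := 2) ?_ (by norm_num)]
  · rw [Real.fourier_real_eq_integral_exp_smul, ← integral_neg]
    simp only [even_two, Even.neg_pow, one_pow, one_smul]
    congr 1; ext w
    have : ((-2 * π * w * -s : ℝ) : ℂ) * I = I * (2 * π * w) * s := by push_cast; ring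
    rw [this]
    simp only [smul_eq_mul]
    linear_combination (Complex.exp (I * (2 * π * w) * s)) * (2 * π * w) ^ 2 * u w * I_sq
  · intro n _
    have := u.integrable_pow_mul volume n
    refine (integrable_norm_iff ?_).1 ?_
    · exact (by fun_prop : Continuous fun x : ℝ => x ^ n • u x).aestronglyMeasurable
    · simpa [norm_smul] using this

lemma neg_deriv2 (f G : 𝓢(ℝ × ℝ, ℂ)) (hG : ∀ ξ, fourier2 f ξ = G ξ) (θ : ℝ × ℝ)
    (h : θ.1 ^ 2 + θ.2 ^ 2 = 1) (s : ℝ) :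
    -(iteratedDeriv 2 (fun s : ℝ => Radon f θ s) s) =
      ∫ r : ℝ, Complex.exp (I * r * s) * ((r : ℂ) ^ 2 * G (r • θ)) := by
  rw [radon_inv f G hG θ h, deriv2_fourierInv, neg_neg]
  have := Measure.integral_comp_mul_left
    (fun r : ℝ => Complex.exp (I * r * s) * ((r : ℂ) ^ 2 * G (r • θ))) (2 * π)
  rw [abs_of_pos (by positivity)] at this
  have h3 := congrArg (fun z => (2 * (π : ℂ)) * z) this
  have hpi : (π : ℂ) ≠ 0 := by exact_mod_cast Real.pi_ne_zero
  simp only [Complex.real_smul] at h3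
  rw [← integral_const_mul, ← mul_assoc] at h3
  have h4 : (2 * (π : ℂ)) * (((2 * π)⁻¹ : ℝ) : ℂ) = 1 := by
    push_cast; field_simp
  rw [h4, one_mul] at h3
  rw [← h3]
  congr 1; ext w
  rw [smul_apply, lineS_apply, smul_eq_mul]
  push_cast
  ring

noncomputable def Qf (G : 𝓢(ℝ × ℝ, ℂ)) (x : ℝ × ℝ) (r φ : ℝ) : ℂ :=
  Complex.exp (I * r * ((x.1 * Real.cos φ + x.2 * Real.sin φ : ℝ) : ℂ)) *
    ((r : ℂ) ^ 2 * G (r • (Real.cos φ, Real.sin φ)))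

lemma Qf_neg (G : 𝓢(ℝ × ℝ, ℂ)) (x : ℝ × ℝ) (r φ : ℝ) : Qf G x (-r) φ = Qf G x r (φ + π) := by
  unfold Qf
  rw [Real.cos_add_pi, Real.sin_add_pi]
  congr 2
  · push_cast; ring
  · push_cast; ring
  · congr 1; ext <;> simp

lemma Qf_periodic (G : 𝓢(ℝ × ℝ, ℂ)) (x : ℝ × ℝ) (r φ : ℝ) :
    Qf G x r (φ + 2 * π) = Qf G x r φ := by
  unfold Qf
  rw [Real.cos_add_two_pi, Real.sin_add_two_pi]

lemma Qf_cont (G : 𝓢(ℝ × ℝ, ℂ)) (x : ℝ × ℝ) :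
    Continuous (fun p : ℝ × ℝ => Qf G x p.1 p.2) := by
  unfold Qf
  have : Continuous fun p : ℝ × ℝ => G (p.1 • (Real.cos p.2, Real.sin p.2)) :=
    G.continuous.comp (by fun_prop)
  fun_prop

lemma Qf_bound (G : 𝓢(ℝ × ℝ, ℂ)) (x : ℝ × ℝ) :
    ∃ C : ℝ, ∀ r φ, ‖Qf G x r φ‖ ≤ C * (1 + r ^ 2)⁻¹ := by
  obtain ⟨C, hC0, hC⟩ := aux_decay G 4
  refine ⟨16 * C, fun r φ => ?_⟩
  have h1 := hC (r • (Real.cos φ, Real.sin φ))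
  unfold Qf
  set y : ℝ × ℝ := r • (Real.cos φ, Real.sin φ) with hy
  have e : I * r * ((x.1 * Real.cos φ + x.2 * Real.sin φ : ℝ) : ℂ) =
    ((r * (x.1 * Real.cos φ + x.2 * Real.sin φ) : ℝ) : ℂ) * I := by push_cast; ring
  rw [norm_mul, e, Complex.norm_exp_ofReal_mul_I, one_mul, norm_mul, norm_pow, Complex.norm_real,
    Real.norm_eq_abs, sq_abs]
  have a := norm_fst_le y
  have b := norm_snd_le y
  have hr : r ^ 2 = y.1 ^ 2 + y.2 ^ 2 := by
    simp only [hy, Prod.smul_mk, smul_eq_mul]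
    linear_combination (-(r ^ 2)) * Real.sin_sq_add_cos_sq φ
  have hr2 : r ^ 2 ≤ 2 * ‖y‖ ^ 2 := by
    simp only [Real.norm_eq_abs] at a b
    rw [hr, ← sq_abs y.1, ← sq_abs y.2]
    have := pow_le_pow_left₀ (abs_nonneg _) a 2
    have := pow_le_pow_left₀ (abs_nonneg _) b 2
    linarith
  have hn := norm_nonneg y
  have h5 : r ^ 2 ≤ 2 * (1 + ‖y‖) ^ 2 := by nlinarith
  have h6 : 1 + r ^ 2 ≤ 2 * (1 + ‖y‖) ^ 2 := by nlinarith
  have h7 : r ^ 2 * (1 + r ^ 2) ≤ 4 * (1 + ‖y‖) ^ 4 := by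
    calc _ ≤ (2 * (1 + ‖y‖) ^ 2) * (2 * (1 + ‖y‖) ^ 2) := by gcongr
      _ = _ := by ring
  rw [← div_eq_mul_inv, le_div_iff₀ (by positivity)]
  calc _ = (r ^ 2 * (1 + r ^ 2)) * ‖G y‖ := by ring
    _ ≤ (4 * (1 + ‖y‖) ^ 4) * ‖G y‖ := by gcongr
    _ = 4 * ((1 + ‖y‖) ^ 4 * ‖G y‖) := by ring
    _ ≤ 16 * C := by linarith

lemma Qf_int1 (G : 𝓢(ℝ × ℝ, ℂ)) (x : ℝ × ℝ) (φ : ℝ) : Integrable (fun r => Qf G x r φ) := by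
  obtain ⟨C, hC⟩ := Qf_bound G x
  refine (integrable_inv_one_add_sq.const_mul C).mono' ?_
    (Filter.Eventually.of_forall fun r => hC r φ)
  exact ((Qf_cont G x).comp (by fun_prop : Continuous fun r : ℝ => (r, φ))).aestronglyMeasurable

lemma Qf_int2 (G : 𝓢(ℝ × ℝ, ℂ)) (x : ℝ × ℝ) :
    Integrable (fun p : ℝ × ℝ => Qf G x p.1 p.2)
      ((volume.restrict (Set.Ioi 0)).prod (volume.restrict (Set.Ioo (-π) π))) := by
  obtain ⟨C, hC⟩ := Qf_bound G x
  have h1 : Integrable (fun r : ℝ => C * (1 + r ^ 2)⁻¹) (volume.restrict (Set.Ioi 0)) :=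
    (integrable_inv_one_add_sq.const_mul C).restrict
  exact (h1.comp_fst _).mono' (Qf_cont G x).aestronglyMeasurable
    (Filter.Eventually.of_forall fun p => hC p.1 p.2)

lemma split (G : 𝓢(ℝ × ℝ, ℂ)) (x : ℝ × ℝ) (φ : ℝ) :
    ∫ r, Qf G x r φ = (∫ r in Set.Ioi 0, Qf G x r φ) + ∫ r in Set.Ioi 0, Qf G x r (φ + π) := by
  have h := integral_comp_neg_Ioi 0 (fun r => Qf G x r φ)
  simp only [Qf_neg, neg_zero] at h
  rw [h, add_comm]
  have := integral_add_compl (measurableSet_Iic (a := (0 : ℝ))) (Qf_int1 G x φ)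
  rw [Set.compl_Iic] at this
  exact this.symm

lemma total (G : 𝓢(ℝ × ℝ, ℂ)) (x : ℝ × ℝ) :
    ∫ φ in (0 : ℝ)..(2 * π), ∫ r, Qf G x r φ =
      2 * ∫ p in polarCoord.target, Qf G x p.1 p.2 := by
  set P : ℝ → ℂ := fun φ => ∫ r in Set.Ioi 0, Qf G x r φ with hP
  have hper : Function.Periodic P (2 * π) := fun φ => by simp only [hP, Qf_periodic]
  have hpp : (0 : ℝ) < 2 * π := by positivity
  have hle : -π ≤ π := by linarith [Real.pi_pos]
  have hI0 : IntervalIntegrable P volume (-π) (-π + 2 * π) := by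
    rw [show -π + 2 * π = π by ring, intervalIntegrable_iff_integrableOn_Ioo_of_le hle]
    exact (Qf_int2 G x).integral_prod_right
  have hI : ∀ a b, IntervalIntegrable P volume a b := fun a b =>
    hper.intervalIntegrable hpp.ne' hI0 a b
  have hI2 : IntervalIntegrable (fun φ => P (φ + π)) volume 0 (2 * π) := by
    have := (hI π (2 * π + π)).comp_add_right π
    simpa using this
  have h1 : ∀ a, ∫ φ in a..(a + 2 * π), P φ = ∫ φ in (-π)..π, P φ := fun a => by
    rw [hper.intervalIntegral_add_eq a (-π)]
    congr 1; ring
  calc _ = ∫ φ in (0 : ℝ)..(2 * π), (P φ + P (φ + π)) := by simp only [split, hP]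
    _ = (∫ φ in (0 : ℝ)..(2 * π), P φ) + ∫ φ in (0 : ℝ)..(2 * π), P (φ + π) :=
      intervalIntegral.integral_add (hI _ _) hI2
    _ = 2 * ∫ φ in (-π)..π, P φ := by
      rw [intervalIntegral.integral_comp_add_right]
      have a := h1 0
      have b := h1 π
      rw [zero_add] at a
      rw [zero_add, a, add_comm (2 * π), b]; ring
    _ = _ := by
      congr 1
      rw [intervalIntegral.integral_of_le hle, integral_Ioc_eq_integral_Ioo]
      have e := integral_prod_symm _ (Qf_int2 G x)
      rw [Measure.prod_restrict, ← Measure.volume_eq_prod] at e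
      exact e.symm

/-- Lambda tomography identity `Λf = F^{-1}(|ξ| f̂)`: for Schwartz `f`, each
`s ↦ Rf(θ,s)` (`θ ∈ S¹`) is twice continuously differentiable and
`(1/(4π)) ∫_{S¹} (-(∂²/∂s²) Rf(θ,s))|_{s=x·θ} dθ = (1/(2π)) ∫_{ℝ²} e^{ix·ξ} |ξ| f̂(ξ) dξ`,
the circle being parametrized by arclength as `θ(φ) = (cos φ, sin φ)`, `φ ∈ [0, 2π]`. -/
theorem stmt_3 (f : SchwartzMap (ℝ × ℝ) ℂ) :
    (∀ θ : ℝ × ℝ, θ.1 ^ 2 + θ.2 ^ 2 = 1 → ContDiff ℝ 2 (fun s : ℝ => Radon f θ s)) ∧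
    ∀ x : ℝ × ℝ,
      (1 / (4 * (π : ℂ))) *
          ∫ φ in (0 : ℝ)..(2 * π),
            -(iteratedDeriv 2 (fun s : ℝ => Radon f (Real.cos φ, Real.sin φ) s)
                (x.1 * Real.cos φ + x.2 * Real.sin φ))
        = (1 / (2 * (π : ℂ))) *
          ∫ ξ : ℝ × ℝ,
            Complex.exp (Complex.I * (x.1 * ξ.1 + x.2 * ξ.2)) *
              (Real.sqrt (ξ.1 ^ 2 + ξ.2 ^ 2) : ℝ) * fourier2 f ξ := by
  obtain ⟨G, hG⟩ := fourier2_schwartz f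
  refine ⟨fun θ h => ?_, fun x => ?_⟩
  · rw [radon_inv f G hG θ h]
    exact SchwartzMap.smooth _ 2
  · have hpi : (π : ℂ) ≠ 0 := by exact_mod_cast Real.pi_ne_zero
    have h1 : ∀ φ : ℝ, -(iteratedDeriv 2 (fun s : ℝ => Radon f (Real.cos φ, Real.sin φ) s)
        (x.1 * Real.cos φ + x.2 * Real.sin φ)) = ∫ r, Qf G x r φ := fun φ =>
      neg_deriv2 f G hG (Real.cos φ, Real.sin φ) (Real.cos_sq_add_sin_sq φ) _
    simp only [h1]
    rw [total, ← integral_comp_polarCoord_symm, ← mul_assoc]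
    congr 1
    · field_simp; norm_num
    · refine setIntegral_congr_fun polarCoord.open_target.measurableSet fun p hp => ?_
      have hp1 : 0 < p.1 := hp.1
      have hs : Real.sqrt ((p.1 * Real.cos p.2) ^ 2 + (p.1 * Real.sin p.2) ^ 2) = p.1 := by
        rw [show (p.1 * Real.cos p.2) ^ 2 + (p.1 * Real.sin p.2) ^ 2 = p.1 ^ 2 by
          linear_combination p.1 ^ 2 * Real.cos_sq_add_sin_sq p.2]
        exact Real.sqrt_sq hp1.le
      simp only [polarCoord_symm_apply, hG, hs, Qf, Complex.real_smul, Prod.smul_mk, smul_eq_mul]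
      have e : I * p.1 * ((x.1 * Real.cos p.2 + x.2 * Real.sin p.2 : ℝ) : ℂ) =
          I * (x.1 * ((p.1 * Real.cos p.2 : ℝ) : ℂ) + x.2 * ((p.1 * Real.sin p.2 : ℝ) : ℂ)) := by
        push_cast; ring
      rw [e]
      ring
end

section
/- (The identity T_1 = L_Φ K R: the limited-angle weighted Lambda reconstruction is the Fourier multiplier with symbol |ξ|κ(ξ/|ξ|)χ_Φ(ξ).) Let 0 < Φ < π/2, let κ : S¹ → ℝ be smooth and even, and let f be a Schwartz function on ℝ². Then for every θ the function s ↦ Rf(θ,s) is twice continuously differentiable, and for every x ∈ ℝ², (1/(4π)) ∫_{S_Φ} κ(θ) · ( -(∂²/∂s²) Rf(θ,s) )|_{s = x·θ} dθ = (1/(2π)) ∫_{ℝ²} e^{i x·ξ} |ξ| κ(ξ/|ξ|) χ_Φ(ξ) f̂(ξ) dξ. -/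
open MeasureTheory Real Complex

/-- `W_Φ = {rθ : r ≠ 0, θ ∈ S_Φ}` where `S_Φ = {±(cos φ, sin φ) : |φ| < Φ}`. -/
def WPhi (Φ : ℝ) : Set (ℝ × ℝ) :=
  {ξ | ∃ r : ℝ, r ≠ 0 ∧ ∃ φ : ℝ, |φ| < Φ ∧ ξ = r • (Real.cos φ, Real.sin φ)}

/-- `χ_Φ`, the characteristic function of the closure of `W_Φ`. -/
noncomputable def chiPhi (Φ : ℝ) (ξ : ℝ × ℝ) : ℝ :=
  (closure (WPhi Φ)).indicator (fun _ => (1 : ℝ)) ξ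

open scoped FourierTransform SchwartzMap

lemma aux_decay_s5 {E : Type*} [NormedAddCommGroup E] [NormedSpace ℝ E] (g : 𝓢(E, ℂ)) (k : ℕ) :
    ∃ C : ℝ, 0 ≤ C ∧ ∀ z, ‖z‖ ^ k * ‖g z‖ ≤ C * (1 + ‖z‖ ^ 2)⁻¹ := by
  obtain ⟨C₁, h₁, H₁⟩ := g.decay k 0
  obtain ⟨C₂, h₂, H₂⟩ := g.decay (k + 2) 0
  refine ⟨C₁ + C₂, by positivity, fun z => ?_⟩
  have a := H₁ z
  have b := H₂ z
  simp only [norm_iteratedFDeriv_zero] at a b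
  rw [← div_eq_mul_inv, le_div_iff₀ (by positivity)]
  rw [pow_add] at b
  linarith

lemma aux_cont (g : 𝓢(ℂ, ℂ)) : Continuous (fun s : ℝ => ∫ t : ℝ, g (s + t * I)) := by
  obtain ⟨C, hC, H⟩ := aux_decay_s5 g 0
  refine continuous_of_dominated (bound := fun t => C * (1 + t ^ 2)⁻¹) ?_ ?_ ?_ ?_
  · intro s
    have := g.continuous
    exact Continuous.aestronglyMeasurable (by fun_prop)
  · intro s
    refine Filter.Eventually.of_forall fun t => ?_
    have h := H (s + t * I)
    simp only [pow_zero, one_mul] at h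
    refine h.trans ?_
    have h3 : t ^ 2 ≤ ‖(s + t * I : ℂ)‖ ^ 2 := by
      rw [← sq_abs t]
      gcongr
      simpa using Complex.abs_im_le_norm (s + t * I)
    gcongr
  · exact integrable_inv_one_add_sq.const_mul C
  · refine Filter.Eventually.of_forall fun t => ?_
    have := g.continuous
    fun_prop

lemma aux_int (G : 𝓢(ℂ, ℂ)) (k : ℕ) : Integrable (fun σ : ℝ => (σ : ℝ) ^ k • G (σ : ℂ)) := by
  obtain ⟨C, hC, H⟩ := aux_decay_s5 G k
  have := G.continuous
  refine (integrable_inv_one_add_sq.const_mul C).mono'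
    (Continuous.aestronglyMeasurable (by fun_prop)) (Filter.Eventually.of_forall fun t => ?_)
  have h := H t
  simpa [norm_smul] using h

lemma aux_intprod (F : ℂ → ℂ) (hF : Integrable F) :
    Integrable (fun p : ℝ × ℝ => F (p.1 + p.2 * I)) := by
  have := (Complex.volume_preserving_equiv_real_prod.symm).integrable_comp_emb
    (measurableEquivRealProd.symm.measurableEmbedding) (g := F)
  have h := this.mpr hF
  refine h.congr (Filter.Eventually.of_forall fun p => ?_)
  simp [measurableEquivRealProd_symm_apply, Complex.mk_eq_add_mul_I]

lemma aux_integral (F : ℂ → ℂ) :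
    ∫ p : ℝ × ℝ, F (p.1 + p.2 * I) = ∫ z, F z := by
  rw [← (Complex.volume_preserving_equiv_real_prod.symm).integral_comp
    (measurableEquivRealProd.symm.measurableEmbedding)]
  simp [measurableEquivRealProd_symm_apply, Complex.mk_eq_add_mul_I]

lemma aux_slice (g : 𝓢(ℂ, ℂ)) :
    (fun s : ℝ => ∫ t : ℝ, g (s + t * I)) = 𝓕⁻ (fun σ : ℝ => (𝓕 g : 𝓢(ℂ, ℂ)) (σ : ℂ)) := by
  have hF : 𝓕 (fun s : ℝ => ∫ t : ℝ, g (s + t * I)) = (fun σ : ℝ => (𝓕 g : 𝓢(ℂ, ℂ)) (σ : ℂ)) := by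
    ext σ
    rw [SchwartzMap.fourier_coe, Real.fourier_eq', Real.fourier_eq', ← aux_integral]
    rw [Measure.volume_eq_prod, integral_prod]
    · congr 1
      ext s
      rw [← integral_smul]
      congr 1
      ext t
      congr 3
      simp [Complex.inner]
    · rw [← Measure.volume_eq_prod]
      refine aux_intprod (fun z => cexp (↑(-2 * π * inner ℝ z (σ:ℂ)) * I) • g z) ?_
      refine g.integrable.norm.mono' ?_ ?_
      · have := g.continuous
        exact Continuous.aestronglyMeasurable (by fun_prop)
      · refine Filter.Eventually.of_forall fun z => ?_
        rw [norm_smul, Complex.norm_exp_ofReal_mul_I, one_mul]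
  rw [← hF]
  refine ((aux_cont g).fourierInv_fourier_eq ?_ ?_).symm
  · have := aux_intprod g g.integrable
    rw [Measure.volume_eq_prod] at this
    exact this.integral_prod_left
  · rw [hF]
    simpa using aux_int (𝓕 g) 0

/-- transported function -/
noncomputable def cg (f : SchwartzMap (ℝ × ℝ) ℂ) : 𝓢(ℂ, ℂ) :=
  SchwartzMap.compCLMOfContinuousLinearEquiv ℂ Complex.equivRealProdCLM f

lemma cg_apply (f : SchwartzMap (ℝ × ℝ) ℂ) (z : ℂ) : cg f z = f (z.re, z.im) := rfl

lemma aux_fourier2 (f : SchwartzMap (ℝ × ℝ) ℂ) (ξ : ℝ × ℝ) :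
    fourier2 f ξ = (1 / (2 * (π : ℂ))) * (𝓕 (cg f) : 𝓢(ℂ, ℂ)) ((2 * π)⁻¹ * (ξ.1 + ξ.2 * I)) := by
  rw [fourier2, SchwartzMap.fourier_coe, Real.fourier_eq', ← aux_integral]
  congr 2
  ext x
  have hpi : (π : ℂ) ≠ 0 := by exact_mod_cast Real.pi_ne_zero
  rw [cg_apply, smul_eq_mul]
  congr 2
  · simp [Complex.inner]
    field_simp
  · simp

/-- rotated function -/
noncomputable def rotg (g : 𝓢(ℂ, ℂ)) (u : Circle) : 𝓢(ℂ, ℂ) :=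
  SchwartzMap.compCLMOfContinuousLinearEquiv ℂ (rotation u).toContinuousLinearEquiv g

lemma aux_radon (f : SchwartzMap (ℝ × ℝ) ℂ) (φ : ℝ) :
    (fun s : ℝ => Radon f (Real.cos φ, Real.sin φ) s) =
      𝓕⁻ (fun σ : ℝ => (𝓕 (cg f) : 𝓢(ℂ, ℂ)) (σ * cexp (φ * I))) := by
  have h := aux_slice (rotg (cg f) (Circle.exp φ))
  have h1 : (fun s : ℝ => Radon f (Real.cos φ, Real.sin φ) s) =
      (fun s : ℝ => ∫ t : ℝ, (rotg (cg f) (Circle.exp φ)) (s + t * I)) := by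
    ext s
    rw [Radon]
    congr 1
    ext t
    change _ = f _
    congr 1
    ext <;> simp [Complex.exp_ofReal_mul_I_re, Complex.exp_ofReal_mul_I_im] <;> ring
  rw [h1, h]
  congr 1
  ext σ
  have := Real.fourier_comp_linearIsometry (rotation (Circle.exp φ)) (cg f) (σ : ℂ)
  rw [SchwartzMap.fourier_coe, SchwartzMap.fourier_coe]
  refine this.trans ?_
  simp [rotation_apply, mul_comm]

lemma aux_int' (G : 𝓢(ℂ, ℂ)) (φ : ℝ) (k : ℕ) :
    Integrable (fun σ : ℝ => (σ : ℝ) ^ k • G (σ * cexp (φ * I))) := by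
  have := aux_int (rotg G (Circle.exp φ)) k
  convert this using 3 with σ
  change _ = G _
  simp [mul_comm]

lemma aux_fi (F : ℝ → ℂ) : 𝓕⁻ F = 𝓕 (fun x => F (-x)) := by
  ext x
  rw [Real.fourierInv_eq_fourier_comp_neg]

lemma aux_radon_smooth (f : SchwartzMap (ℝ × ℝ) ℂ) (φ : ℝ) :
    ContDiff ℝ 2 (fun s : ℝ => Radon f (Real.cos φ, Real.sin φ) s) := by
  rw [aux_radon, aux_fi]
  have := Real.contDiff_fourier (N := 2)
    (f := fun x : ℝ => (𝓕 (cg f) : 𝓢(ℂ, ℂ)) ((-x : ℝ) * cexp (φ * I))) ?_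
  · exact this
  intro n _
  have := (aux_int' (𝓕 (cg f)) φ n).comp_neg.norm
  refine this.congr (Filter.Eventually.of_forall fun x => ?_)
  simp

lemma aux_radon_deriv (f : SchwartzMap (ℝ × ℝ) ℂ) (φ s : ℝ) :
    -(iteratedDeriv 2 (fun s : ℝ => Radon f (Real.cos φ, Real.sin φ) s) s) =
      ∫ σ : ℝ, σ ^ 2 * cexp (I * (σ * s)) * fourier2 f (σ * Real.cos φ, σ * Real.sin φ) := by
  have hpi : (π : ℂ) ≠ 0 := by exact_mod_cast Real.pi_ne_zero
  rw [aux_radon, aux_fi, Real.iteratedDeriv_fourier (N := 2)]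
  · rw [Real.fourier_eq', ← integral_neg]
    have h := Measure.integral_comp_mul_left (fun σ : ℝ => (σ:ℂ) ^ 2 * cexp (I * (σ * s)) *
      fourier2 f (σ * Real.cos φ, σ * Real.sin φ)) (-(2 * π))
    have h2 : |(-(2 * π))⁻¹| = (2 * π)⁻¹ := by
      rw [abs_inv, abs_neg, abs_of_pos (by positivity)]
    rw [h2, eq_inv_smul_iff₀ (by positivity)] at h
    rw [← h, ← integral_smul]
    congr 1
    ext σ
    have e : fourier2 f (-(2 * π) * σ * Real.cos φ, -(2 * π) * σ * Real.sin φ) =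
        (1 / (2 * (π : ℂ))) * (𝓕 (cg f) : 𝓢(ℂ, ℂ)) (((-σ : ℝ) : ℂ) * cexp (φ * I)) := by
      rw [aux_fourier2]
      congr 2
      rw [Complex.exp_mul_I]
      push_cast
      field_simp
      ring
    rw [e]
    have e2 : cexp (I * (((-(2 * π) * σ : ℝ) : ℂ) * s)) =
      cexp (((-2 * π * inner ℝ σ s : ℝ) : ℂ) * I) := by
      congr 1
      simp
      ring
    rw [e2]
    simp only [smul_eq_mul, Complex.real_smul]
    push_cast
    generalize cexp (-2 * (π : ℂ) * (inner ℝ σ s : ℝ) * I) = A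
    generalize (𝓕 (cg f) : 𝓢(ℂ, ℂ)) _ = B
    field_simp
    ring_nf
    simp
  · intro n _
    have := (aux_int' (𝓕 (cg f)) φ n).comp_neg
    refine (this.const_mul ((-1) ^ n)).congr (Filter.Eventually.of_forall fun x => ?_)
    simp [← mul_assoc, ← mul_pow]
  · norm_num

lemma aux_radon_contDiff (f : SchwartzMap (ℝ × ℝ) ℂ) (θ : ℝ × ℝ) :
    ContDiff ℝ 2 (fun s : ℝ => Radon f θ s) := by
  obtain ⟨r, φ, hr, h1, h2⟩ : ∃ r φ : ℝ, 0 ≤ r ∧ θ.1 = r * Real.cos φ ∧ θ.2 = r * Real.sin φ := by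
    refine ⟨‖(⟨θ.1, θ.2⟩ : ℂ)‖, Complex.arg ⟨θ.1, θ.2⟩, norm_nonneg _, ?_, ?_⟩
    · rw [Complex.norm_mul_cos_arg]
    · rw [Complex.norm_mul_sin_arg]
  have : (fun s : ℝ => Radon f θ s) =
      fun s => ∫ t : ℝ, f ((r * s) • (Real.cos φ, Real.sin φ) +
        (r * t) • (-Real.sin φ, Real.cos φ)) := by
    ext s
    rw [Radon]
    congr 1
    ext t
    congr 1
    ext
    · simp [h1, h2]; ring
    · simp [h1, h2]; ring
  rw [this]
  rcases hr.eq_or_lt with h0 | h0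
  · simp only [← h0, zero_mul]
    exact contDiff_const
  · have h3 : ∀ s : ℝ, ∫ t : ℝ, f ((r * s) • (Real.cos φ, Real.sin φ) +
        (r * t) • (-Real.sin φ, Real.cos φ)) =
        |r⁻¹| • Radon f (Real.cos φ, Real.sin φ) (r * s) := by
      intro s
      exact Measure.integral_comp_mul_left
        (fun t => f ((r * s) • (Real.cos φ, Real.sin φ) + t • (-Real.sin φ, Real.cos φ))) r
    simp only [h3]
    have h4 := (aux_radon_smooth f φ).comp (contDiff_const.mul contDiff_id : ContDiff ℝ 2 (fun s : ℝ => r * s))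
    exact h4.const_smul _

lemma aux_radon_neg (f : SchwartzMap (ℝ × ℝ) ℂ) (a b : ℝ) (s : ℝ) :
    Radon f (-a, -b) s = Radon f (a, b) (-s) := by
  rw [Radon, Radon, ← integral_neg_eq_self]
  congr 1
  ext t
  congr 1
  ext <;> simp

lemma aux_W_sub (Φ : ℝ) (hΦ : Φ ∈ Set.Ioo 0 (π / 2)) (ξ : ℝ × ℝ) (h : ξ ∈ WPhi Φ) :
    |ξ.2| * Real.cos Φ ≤ Real.sin Φ * |ξ.1| := by
  obtain ⟨h0, h1⟩ := hΦ
  obtain ⟨r, hr, φ, hφ, rfl⟩ := h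
  obtain ⟨ha, hb⟩ := abs_lt.1 hφ
  have hc : 0 < Real.cos φ := Real.cos_pos_of_mem_Ioo ⟨by linarith, by linarith⟩
  have hp : 0 ≤ Real.sin (Φ - φ) := Real.sin_nonneg_of_nonneg_of_le_pi (by linarith) (by linarith)
  have hm : 0 ≤ Real.sin (Φ + φ) := Real.sin_nonneg_of_nonneg_of_le_pi (by linarith) (by linarith)
  rw [Real.sin_sub] at hp
  rw [Real.sin_add] at hm
  have hcΦ : 0 < Real.cos Φ := Real.cos_pos_of_mem_Ioo ⟨by linarith, by linarith⟩
  simp only [Prod.smul_mk, smul_eq_mul, abs_mul, abs_of_pos hc]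
  have : |Real.sin φ| * Real.cos Φ ≤ Real.sin Φ * Real.cos φ := by
    rcases abs_cases (Real.sin φ) with ⟨h, _⟩ | ⟨h, _⟩ <;> rw [h] <;> linarith
  nlinarith [abs_nonneg r]

lemma aux_W_sup (Φ : ℝ) (hΦ : Φ ∈ Set.Ioo 0 (π / 2)) (ξ : ℝ × ℝ)
    (h : |ξ.2| * Real.cos Φ < Real.sin Φ * |ξ.1|) : ξ ∈ WPhi Φ := by
  obtain ⟨h0, h1⟩ := hΦ
  have hcΦ : 0 < Real.cos Φ := Real.cos_pos_of_mem_Ioo ⟨by linarith, by linarith⟩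
  have hx : ξ.1 ≠ 0 := by
    intro hx
    rw [hx] at h
    simp at h
    have : 0 ≤ |ξ.2| * Real.cos Φ := by positivity
    linarith
  have hc := Real.cos_arctan_pos (ξ.2 / ξ.1)
  have ht : |ξ.2 / ξ.1| < Real.tan Φ := by
    rw [abs_div, Real.tan_eq_sin_div_cos, div_lt_div_iff₀ (abs_pos.2 hx) hcΦ]
    exact h
  have hat : Real.arctan (Real.tan Φ) = Φ := Real.arctan_tan (by linarith) h1
  refine ⟨ξ.1 / Real.cos (Real.arctan (ξ.2 / ξ.1)), div_ne_zero hx hc.ne',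
    Real.arctan (ξ.2 / ξ.1), ?_, ?_⟩
  · rw [abs_lt] at ht ⊢
    constructor
    · have := Real.arctan_strictMono ht.1
      rwa [Real.arctan_neg, hat] at this
    · have := Real.arctan_strictMono ht.2
      rwa [hat] at this
  · ext
    · simp only [Prod.smul_mk, smul_eq_mul]
      field_simp
    · simp only [Prod.smul_mk, smul_eq_mul]
      rw [div_mul_eq_mul_div, mul_div_assoc, ← Real.tan_eq_sin_div_cos, Real.tan_arctan]
      field_simp

lemma aux_line (a b : ℝ) (hb : b ≠ 0) :
    volume {ξ : ℝ × ℝ | ξ.2 * b = a * ξ.1} = 0 := by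
  have : {ξ : ℝ × ℝ | ξ.2 * b = a * ξ.1} =
      (LinearMap.ker (b • LinearMap.snd ℝ ℝ ℝ - a • LinearMap.fst ℝ ℝ ℝ) : Set (ℝ × ℝ)) := by
    ext ξ
    simp [sub_eq_zero, mul_comm]
  rw [this]
  apply Measure.addHaar_submodule
  rw [Ne, LinearMap.ker_eq_top]
  intro h
  have := LinearMap.congr_fun h (0, 1)
  simp at this
  exact hb this

lemma aux_W_ae (Φ : ℝ) (hΦ : Φ ∈ Set.Ioo 0 (π / 2)) :
    (closure (WPhi Φ) : Set (ℝ × ℝ)) =ᵐ[volume] WPhi Φ := by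
  have hcΦ : 0 < Real.cos Φ := Real.cos_pos_of_mem_Ioo ⟨by linarith [hΦ.1, Real.pi_pos], hΦ.2⟩
  have hcl : closure (WPhi Φ) ⊆ {ξ : ℝ × ℝ | |ξ.2| * Real.cos Φ ≤ Real.sin Φ * |ξ.1|} :=
    closure_minimal (aux_W_sub Φ hΦ) (isClosed_le (by fun_prop) (by fun_prop))
  have hnull : volume (closure (WPhi Φ) \ WPhi Φ) = 0 := by
    refine measure_mono_null (t := {ξ : ℝ × ℝ | ξ.2 * Real.cos Φ = Real.sin Φ * ξ.1} ∪
      {ξ : ℝ × ℝ | ξ.2 * Real.cos Φ = (-Real.sin Φ) * ξ.1}) ?_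
      (measure_union_null (aux_line _ _ hcΦ.ne') (aux_line _ _ hcΦ.ne'))
    rintro ξ ⟨h1, h2⟩
    have a := hcl h1
    have b : ¬ _ := fun h => h2 (aux_W_sup Φ hΦ ξ h)
    have c : |ξ.2| * Real.cos Φ = Real.sin Φ * |ξ.1| := le_antisymm a (not_lt.1 b)
    simp only [Set.mem_union, Set.mem_ofPred_eq]
    rcases abs_choice ξ.1 with h | h <;> rcases abs_choice ξ.2 with h' | h' <;>
      rw [h, h'] at c
    · left; linarith
    · right; linarith
    · right; linarith
    · left; linarith
  refine Filter.EventuallyLE.antisymm ?_ subset_closure.eventuallyLE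
  exact ae_le_set.2 hnull

lemma aux_W_image (Φ : ℝ) :
    WPhi Φ = polarCoord.symm '' ({0}ᶜ ×ˢ Set.Ioo (-Φ) Φ) := by
  ext ξ
  constructor
  · rintro ⟨r, hr, φ, hφ, rfl⟩
    exact ⟨(r, φ), ⟨hr, abs_lt.1 hφ⟩, by simp [polarCoord]⟩
  · rintro ⟨⟨r, φ⟩, ⟨hr, hφ⟩, rfl⟩
    exact ⟨r, hr, φ, abs_lt.2 hφ, by simp [polarCoord]⟩

lemma aux_W_inj (Φ : ℝ) (hΦ : Φ ∈ Set.Ioo 0 (π / 2)) :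
    Set.InjOn polarCoord.symm ({0}ᶜ ×ˢ Set.Ioo (-Φ) Φ : Set (ℝ × ℝ)) := by
  rintro ⟨r, φ⟩ ⟨hr, hφ⟩ ⟨r', φ'⟩ ⟨hr', hφ'⟩ h
  simp only [Set.mem_compl_iff, Set.mem_singleton_iff, Set.mem_Ioo] at hr hφ hr' hφ'
  obtain ⟨h0, h1⟩ := hΦ
  have hc : 0 < Real.cos φ := Real.cos_pos_of_mem_Ioo ⟨by linarith, by linarith⟩
  have hc' : 0 < Real.cos φ' := Real.cos_pos_of_mem_Ioo ⟨by linarith, by linarith⟩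
  simp only [polarCoord_symm_apply, Prod.mk.injEq] at h
  have ht : Real.tan φ = Real.tan φ' := by
    rw [Real.tan_eq_sin_div_cos, Real.tan_eq_sin_div_cos,
      ← mul_div_mul_left _ _ hr, h.1, h.2, mul_div_mul_left _ _ hr']
  have hφe : φ = φ' := Real.injOn_tan ⟨by linarith, by linarith⟩ ⟨by linarith, by linarith⟩ ht
  subst hφe
  have := mul_right_cancel₀ hc.ne' h.1
  rw [this]

lemma aux_bound (f : SchwartzMap (ℝ × ℝ) ℂ) :
    ∃ b : ℝ → ℝ, Integrable b ∧ ∀ σ φ : ℝ,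
      ‖(σ : ℂ) ^ 2 * fourier2 f (σ * Real.cos φ, σ * Real.sin φ)‖ ≤ b σ := by
  obtain ⟨C, hC, H⟩ := aux_decay_s5 (𝓕 (cg f) : 𝓢(ℂ, ℂ)) 2
  refine ⟨fun σ => 2 * π * C * (1 + ((2 * π)⁻¹ * σ) ^ 2)⁻¹, ?_, fun σ φ => ?_⟩
  · exact (integrable_inv_one_add_sq.comp_mul_left' (by positivity)).const_mul _
  · rw [aux_fourier2]
    have e : (((2 * π)⁻¹ : ℝ) : ℂ) * (((σ * Real.cos φ : ℝ) : ℂ) + ((σ * Real.sin φ : ℝ) : ℂ) * I) =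
      (((2 * π)⁻¹ * σ : ℝ) : ℂ) * cexp (φ * I) := by
        rw [Complex.exp_mul_I]
        push_cast
        ring
    have h := H ((((2 * π)⁻¹ * σ : ℝ) : ℂ) * cexp (φ * I))
    change ‖(σ : ℂ) ^ 2 * (1 / (2 * (π : ℂ)) * (𝓕 (cg f) : 𝓢(ℂ, ℂ))
      ((((2 * π)⁻¹ : ℝ) : ℂ) * (((σ * Real.cos φ : ℝ) : ℂ) + ((σ * Real.sin φ : ℝ) : ℂ) * I)))‖ ≤ _
    rw [e]
    rw [norm_mul (_ : ℂ) (cexp _), Complex.norm_exp_ofReal_mul_I, mul_one, Complex.norm_real,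
      Real.norm_eq_abs, sq_abs] at h
    rw [norm_mul, norm_mul, norm_pow, Complex.norm_real, Real.norm_eq_abs, sq_abs]
    have e3 : ‖1 / (2 * (π : ℂ))‖ = (2 * π)⁻¹ := by
      simp [abs_of_pos Real.pi_pos]
    rw [e3]
    have := mul_le_mul_of_nonneg_left h (by positivity : 0 ≤ 2 * π)
    refine le_trans (le_of_eq ?_) (this.trans (le_of_eq ?_))
    · have := Real.pi_pos
      field_simp
    · ring

lemma aux_fourier2_cont (f : SchwartzMap (ℝ × ℝ) ℂ) : Continuous (fourier2 f) := by
  have : fourier2 f = fun ξ => (1 / (2 * (π : ℂ))) *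
    (𝓕 (cg f) : 𝓢(ℂ, ℂ)) ((2 * π)⁻¹ * (ξ.1 + ξ.2 * I)) := funext (aux_fourier2 f)
  rw [this]
  have := (𝓕 (cg f) : 𝓢(ℂ, ℂ)).continuous
  fun_prop

lemma aux_swap (Φ : ℝ) (k : ℝ → ℝ) (hk : Continuous k)
    (f : SchwartzMap (ℝ × ℝ) ℂ) (x : ℝ × ℝ) :
    ∫ p in ({0}ᶜ ×ˢ Set.Ioo (-Φ) Φ : Set (ℝ × ℝ)), (k p.2 : ℂ) * ((p.1 : ℂ) ^ 2 *
      cexp (I * (p.1 * ((x.1 * Real.cos p.2 + x.2 * Real.sin p.2 : ℝ) : ℂ))) *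
        fourier2 f (p.1 * Real.cos p.2, p.1 * Real.sin p.2)) =
    ∫ φ in Set.Ioo (-Φ) Φ, (k φ : ℂ) * ∫ σ : ℝ, (σ : ℂ) ^ 2 *
      cexp (I * (σ * ((x.1 * Real.cos φ + x.2 * Real.sin φ : ℝ) : ℂ))) *
        fourier2 f (σ * Real.cos φ, σ * Real.sin φ) := by
  obtain ⟨b, hb, H⟩ := aux_bound f
  obtain ⟨M, hM⟩ := (isCompact_Icc (a := -Φ) (b := Φ)).exists_bound_of_continuousOn hk.continuousOn
  have hcf := aux_fourier2_cont f
  have hae : (({0}ᶜ : Set ℝ)) =ᵐ[volume] Set.univ := by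
    simp [ae_eq_univ]
  have hm : (volume : Measure (ℝ × ℝ)).restrict ({0}ᶜ ×ˢ Set.Ioo (-Φ) Φ) =
      (volume : Measure ℝ).prod (volume.restrict (Set.Ioo (-Φ) Φ)) := by
    rw [Measure.volume_eq_prod, ← Measure.prod_restrict, Measure.restrict_congr_set hae,
      Measure.restrict_univ]
  rw [hm, integral_prod_symm]
  · congr 1
    ext φ
    dsimp only
    rw [integral_const_mul]
  · have hbM : Integrable (fun p : ℝ × ℝ => b p.1 * M)
      ((volume : Measure ℝ).prod (volume.restrict (Set.Ioo (-Φ) Φ))) :=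
      hb.mul_prod (integrable_const M)
    refine hbM.mono' (Continuous.aestronglyMeasurable (by fun_prop)) ?_
    rw [← hm]
    refine (ae_restrict_iff' (by measurability)).2 (Filter.Eventually.of_forall ?_)
    rintro ⟨σ, φ⟩ ⟨-, hφ⟩
    have h1 := H σ φ
    have h2 := hM φ (Set.Ioo_subset_Icc_self hφ)
    simp only
    have e : ‖cexp (I * (σ * ((x.1 * Real.cos φ + x.2 * Real.sin φ : ℝ) : ℂ)))‖ = 1 := by
      rw [mul_comm, ← Complex.ofReal_mul, Complex.norm_exp_ofReal_mul_I]
    rw [norm_mul, norm_mul, norm_mul, e, mul_one, ← norm_mul, Complex.norm_real, mul_comm]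
    exact mul_le_mul h1 h2 (norm_nonneg _) ((norm_nonneg _).trans h1)

lemma aux_rhs (Φ : ℝ) (hΦ : Φ ∈ Set.Ioo 0 (π / 2))
    (κ : ℝ × ℝ → ℝ) (hκ : Continuous κ)
    (hκeven : ∀ θ : ℝ × ℝ, κ (-θ) = κ θ)
    (f : SchwartzMap (ℝ × ℝ) ℂ) (x : ℝ × ℝ) :
    ∫ ξ : ℝ × ℝ,
            Complex.exp (Complex.I * (x.1 * ξ.1 + x.2 * ξ.2)) *
              (Real.sqrt (ξ.1 ^ 2 + ξ.2 ^ 2) : ℝ) *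
              (κ ((Real.sqrt (ξ.1 ^ 2 + ξ.2 ^ 2))⁻¹ • ξ) : ℝ) *
              (chiPhi Φ ξ : ℝ) * fourier2 f ξ =
    ∫ φ in Set.Ioo (-Φ) Φ, (κ (Real.cos φ, Real.sin φ) : ℂ) * ∫ σ : ℝ, (σ : ℂ) ^ 2 *
      cexp (I * (σ * ((x.1 * Real.cos φ + x.2 * Real.sin φ : ℝ) : ℂ))) *
        fourier2 f (σ * Real.cos φ, σ * Real.sin φ) := by
  have hS : MeasurableSet ({0}ᶜ ×ˢ Set.Ioo (-Φ) Φ : Set (ℝ × ℝ)) := by measurability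
  rw [← aux_swap Φ (fun φ => κ (Real.cos φ, Real.sin φ)) (by fun_prop) f x]
  have h1 : ∀ ξ : ℝ × ℝ, Complex.exp (Complex.I * (x.1 * ξ.1 + x.2 * ξ.2)) *
              (Real.sqrt (ξ.1 ^ 2 + ξ.2 ^ 2) : ℝ) *
              (κ ((Real.sqrt (ξ.1 ^ 2 + ξ.2 ^ 2))⁻¹ • ξ) : ℝ) *
              (chiPhi Φ ξ : ℝ) * fourier2 f ξ = (closure (WPhi Φ)).indicator
      (fun ξ => Complex.exp (Complex.I * (x.1 * ξ.1 + x.2 * ξ.2)) *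
              (Real.sqrt (ξ.1 ^ 2 + ξ.2 ^ 2) : ℝ) *
              (κ ((Real.sqrt (ξ.1 ^ 2 + ξ.2 ^ 2))⁻¹ • ξ) : ℝ) * fourier2 f ξ) ξ := by
    intro ξ
    by_cases h : ξ ∈ closure (WPhi Φ) <;> simp [chiPhi, h]
  simp only [h1]
  rw [integral_indicator isClosed_closure.measurableSet, setIntegral_congr_set (aux_W_ae Φ hΦ),
    aux_W_image, integral_image_eq_integral_abs_det_fderiv_smul volume hS
      (fun p _ => (hasFDerivAt_polarCoord_symm p).hasFDerivWithinAt) (aux_W_inj Φ hΦ)]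
  refine setIntegral_congr_fun hS ?_
  rintro ⟨σ, φ⟩ ⟨hσ, -⟩
  have hσ : σ ≠ 0 := hσ
  simp only [det_fderivPolarCoordSymm, polarCoord_symm_apply]
  have hs : Real.sqrt ((σ * Real.cos φ) ^ 2 + (σ * Real.sin φ) ^ 2) = |σ| := by
    rw [← Real.sqrt_sq_eq_abs]
    congr 1
    linear_combination σ ^ 2 * Real.sin_sq_add_cos_sq φ
  rw [hs]
  have hk : κ (|σ|⁻¹ • (σ * Real.cos φ, σ * Real.sin φ)) = κ (Real.cos φ, Real.sin φ) := by
    rcases lt_or_gt_of_ne hσ with h | h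
    · rw [← hκeven, abs_of_neg h]
      congr 1
      ext <;> simp <;> field_simp
    · rw [abs_of_pos h]
      congr 1
      ext <;> simp <;> field_simp
  rw [hk]
  have ha : ((|σ| : ℝ) : ℂ) * ((|σ| : ℝ) : ℂ) = (σ : ℂ) ^ 2 := by
    rw [← Complex.ofReal_mul, abs_mul_abs_self, Complex.ofReal_mul, sq]
  have he : cexp (I * (x.1 * ((σ * Real.cos φ : ℝ) : ℂ) + x.2 * ((σ * Real.sin φ : ℝ) : ℂ))) =
      cexp (I * (σ * ((x.1 * Real.cos φ + x.2 * Real.sin φ : ℝ) : ℂ))) := by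
    congr 1
    push_cast
    ring
  rw [he, ← ha, Complex.real_smul]
  ring

/-- The identity `T_1 = L_Φ K R`: for a smooth even weight `κ` and Schwartz `f`, each
`s ↦ Rf(θ,s)` is twice continuously differentiable and
`(1/(4π)) ∫_{S_Φ} κ(θ)(-(∂²/∂s²)Rf(θ,s))|_{s=x·θ} dθ
  = (1/(2π)) ∫_{ℝ²} e^{ix·ξ} |ξ| κ(ξ/|ξ|) χ_Φ(ξ) f̂(ξ) dξ`,
where `S_Φ` is parametrized by arclength via `φ ↦ ±(cos φ, sin φ)`, `|φ| < Φ`. -/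
theorem stmt_5 (Φ : ℝ) (hΦ : Φ ∈ Set.Ioo 0 (π / 2))
    (κ : ℝ × ℝ → ℝ) (hκ : ContDiff ℝ (⊤ : ℕ∞) κ)
    (hκeven : ∀ θ : ℝ × ℝ, κ (-θ) = κ θ)
    (f : SchwartzMap (ℝ × ℝ) ℂ) :
    (∀ θ : ℝ × ℝ, ContDiff ℝ 2 (fun s : ℝ => Radon f θ s)) ∧
    ∀ x : ℝ × ℝ,
      (1 / (4 * (π : ℂ))) *
          ∫ φ in (-Φ)..Φ,
            ((κ (Real.cos φ, Real.sin φ) : ℝ) *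
                (-(iteratedDeriv 2 (fun s : ℝ => Radon f (Real.cos φ, Real.sin φ) s)
                    (x.1 * Real.cos φ + x.2 * Real.sin φ))) +
              (κ (-(Real.cos φ), -(Real.sin φ)) : ℝ) *
                (-(iteratedDeriv 2
                    (fun s : ℝ => Radon f (-(Real.cos φ), -(Real.sin φ)) s)
                    (x.1 * (-(Real.cos φ)) + x.2 * (-(Real.sin φ))))))
        = (1 / (2 * (π : ℂ))) *
          ∫ ξ : ℝ × ℝ,
            Complex.exp (Complex.I * (x.1 * ξ.1 + x.2 * ξ.2)) *
              (Real.sqrt (ξ.1 ^ 2 + ξ.2 ^ 2) : ℝ) *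
              (κ ((Real.sqrt (ξ.1 ^ 2 + ξ.2 ^ 2))⁻¹ • ξ) : ℝ) *
              (chiPhi Φ ξ : ℝ) * fourier2 f ξ := by

  refine ⟨aux_radon_contDiff f, fun x => ?_⟩
  rw [aux_rhs Φ hΦ κ hκ.continuous hκeven f x,
    intervalIntegral.integral_of_le (by linarith [hΦ.1]), integral_Ioc_eq_integral_Ioo,
    ← integral_const_mul, ← integral_const_mul]
  congr 1
  ext φ
  rw [← aux_radon_deriv]
  have hk : κ (-(Real.cos φ), -(Real.sin φ)) = κ (Real.cos φ, Real.sin φ) :=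
    hκeven (Real.cos φ, Real.sin φ)
  have hd : iteratedDeriv 2 (fun s : ℝ => Radon f (-(Real.cos φ), -(Real.sin φ)) s)
      (x.1 * (-(Real.cos φ)) + x.2 * (-(Real.sin φ))) =
      iteratedDeriv 2 (fun s : ℝ => Radon f (Real.cos φ, Real.sin φ) s)
        (x.1 * Real.cos φ + x.2 * Real.sin φ) := by
    simp only [aux_radon_neg]
    rw [iteratedDeriv_comp_neg 2 (fun s : ℝ => Radon f (Real.cos φ, Real.sin φ) s)]
    rw [show -(x.1 * (-(Real.cos φ)) + x.2 * (-(Real.sin φ))) =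
      x.1 * Real.cos φ + x.2 * Real.sin φ by ring]
    simp
  rw [hk, hd]
  ring
end

section
/- (The derivative computation of Section 5: the restriction of κρ₁ to the line through the edge direction e₁ inherits the order-k vanishing of ϰ at Φ.) Let Φ ∈ (0, π/2), k a natural number, and κ : ℝ² \ {0} → ℝ smooth and homogeneous of degree 0. Set ϰ(φ) = κ(cos φ, sin φ) and assume ϰ^{(l)}(Φ) = 0 for all 0 ≤ l ≤ k-1. Let e₁ = (cos Φ, sin Φ) and e₁^⊥ = (-sin Φ, cos Φ), and define g : ℝ → ℝ by g(τ) = κ(e₁ + τ e₁^⊥). Then g^{(l)}(0) = 0 for all 0 ≤ l ≤ k-1 and g^{(k)}(0) = ϰ^{(k)}(Φ). -/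
open Real Complex

lemma aux_chain (h : ℝ → ℝ) (hh : ContDiff ℝ (⊤ : ℕ∞) h) (h1 : deriv h 0 = 1) (k : ℕ) :
    ∀ a f : ℝ → ℝ, ContDiff ℝ (⊤ : ℕ∞) a → ContDiff ℝ (⊤ : ℕ∞) f →
      (∀ l < k, iteratedDeriv l f (h 0) = 0) →
      iteratedDeriv k (fun t => a t * f (h t)) 0 = a 0 * iteratedDeriv k f (h 0) := by
  induction k with
  | zero => intro a f _ _ _; simp
  | succ k ih =>
    intro a f ha hf hv
    have hd : ∀ {u : ℝ → ℝ}, ContDiff ℝ (⊤ : ℕ∞) u → ContDiff ℝ (⊤ : ℕ∞) (deriv u) :=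
      fun hu => (contDiff_infty_iff_deriv.1 hu).2
    have hdf : ∀ {u : ℝ → ℝ}, ContDiff ℝ (⊤ : ℕ∞) u → Differentiable ℝ u :=
      fun hu => (contDiff_infty_iff_deriv.1 hu).1
    have e : deriv (fun t => a t * f (h t)) =
        (fun t => deriv a t * f (h t)) + (fun t => (a t * deriv h t) * deriv f (h t)) := by
      funext t
      have := ((hdf ha) t).hasDerivAt.mul
        (((hdf hf) (h t)).hasDerivAt.comp t ((hdf hh) t).hasDerivAt)
      refine this.deriv.trans ?_
      simp only [Pi.add_apply, Function.comp]
      ring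
    have c1 : ContDiff ℝ (⊤ : ℕ∞) (fun t => deriv a t * f (h t)) :=
      (hd ha).mul (hf.comp hh)
    have c2 : ContDiff ℝ (⊤ : ℕ∞) (fun t => (a t * deriv h t) * deriv f (h t)) :=
      (ha.mul (hd hh)).mul ((hd hf).comp hh)
    have hk : ((k : ℕ) : WithTop ℕ∞) ≤ ((⊤ : ℕ∞) : WithTop ℕ∞) := by
      exact_mod_cast (le_top : (k : ℕ∞) ≤ ⊤)
    rw [iteratedDeriv_succ', e, iteratedDeriv_add (c1.of_le hk).contDiffAt
      (c2.of_le hk).contDiffAt, ih _ _ (hd ha) hf (fun l hl => hv l (by omega)),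
      ih _ _ (ha.mul (hd hh)) (hd hf)
        (fun l hl => by rw [← iteratedDeriv_succ']; exact hv (l + 1) (by omega)),
      hv k (by omega), h1, iteratedDeriv_succ']
    ring

/-- The restriction of a homogeneous-of-degree-zero smooth function `κ` to the line
through the edge direction `e₁ = (cos Φ, sin Φ)` inherits the order-`k` vanishing of
`ϰ(φ) = κ(cos φ, sin φ)` at `Φ`: for `g(τ) = κ(e₁ + τ e₁^⊥)` one has `g^{(l)}(0) = 0`
for `0 ≤ l ≤ k-1` and `g^{(k)}(0) = ϰ^{(k)}(Φ)`. -/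
theorem stmt_19 (Φ : ℝ) (hΦ : Φ ∈ Set.Ioo 0 (π / 2)) (k : ℕ) (κ : ℝ × ℝ → ℝ)
    (hκ : ContDiffOn ℝ (⊤ : ℕ∞) κ {ξ : ℝ × ℝ | ξ ≠ 0})
    (hhom : ∀ r : ℝ, 0 < r → ∀ ξ : ℝ × ℝ, ξ ≠ 0 → κ (r • ξ) = κ ξ)
    (ϰ : ℝ → ℝ) (hϰ : ϰ = fun φ => κ (Real.cos φ, Real.sin φ))
    (hvan : ∀ l < k, iteratedDeriv l ϰ Φ = 0)
    (g : ℝ → ℝ)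
    (hgdef : g = fun τ =>
      κ ((Real.cos Φ, Real.sin Φ) + τ • (-Real.sin Φ, Real.cos Φ))) :
    (∀ l < k, iteratedDeriv l g 0 = 0) ∧ iteratedDeriv k g 0 = iteratedDeriv k ϰ Φ := by
  have hsm : ContDiff ℝ (⊤ : ℕ∞) ϰ := by
    rw [hϰ, ← contDiffOn_univ]
    refine hκ.comp (Real.contDiff_cos.prodMk Real.contDiff_sin).contDiffOn ?_
    intro φ _ h0
    have h2 := Prod.mk.inj h0
    have := Real.sin_sq_add_cos_sq φ
    rw [h2.1, h2.2] at this
    norm_num at this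
  have hg : g = fun τ => (fun _ => (1 : ℝ)) τ * ϰ ((fun t => Φ + Real.arctan t) τ) := by
    rw [hgdef, hϰ]
    funext τ
    have hc := Real.cos_arctan_pos τ
    have hs : Real.sin (Real.arctan τ) = τ * Real.cos (Real.arctan τ) := by
      rw [← Real.tan_mul_cos hc.ne', Real.tan_arctan]
    rw [one_mul, ← hhom _ hc]
    · congr 1
      ext
      · simp [Real.cos_add, hs]; ring
      · simp [Real.sin_add, hs]; ring
    · intro h0
      have h2 := Prod.mk.inj h0
      have h3 : Real.cos Φ + τ * (-Real.sin Φ) = 0 := h2.1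
      have h4 : Real.sin Φ + τ * Real.cos Φ = 0 := h2.2
      have := Real.sin_sq_add_cos_sq Φ
      have h5 : (1 : ℝ) = 0 := by
        linear_combination Real.cos Φ * h3 + Real.sin Φ * h4 - this
      exact one_ne_zero h5
  have key : ∀ m ≤ k, iteratedDeriv m g 0 = iteratedDeriv m ϰ Φ := by
    intro m hm
    rw [hg, aux_chain (fun t => Φ + Real.arctan t) (contDiff_const.add Real.contDiff_arctan)
      (by simp) m (fun _ => 1) ϰ contDiff_const hsm
      (fun l hl => by simpa using hvan l (by omega))]
    simp
  exact ⟨fun l hl => (key l hl.le).trans (hvan l hl), key k le_rfl⟩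
end
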